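/- Let R_1 = T_1·i(i+1)i·T_2 be a reduced word for the longest element w_0 ∈ S_n, let u = w(T_1), and set a = u(i), b = u(i+1), c = u(i+2); then a < b < c. Let v = Dem(T_1·i·T_2). Define A = {u(j) : j ≤ i+1 and u(j) ∈ [a,c]} = {a = g_1 < g_2 < ⋯ < g_r} and B = {u(j) : j ≥ i+2 and u(j) ∈ [a,c]} = {h_1 < h_2 < ⋯ < h_s = c}, and let σ ∈ S_n be the cycle given by σ(g_j) = g_{j+1} for 1 ≤ j < r, σ(g_r) = h_s, σ(h_j) = h_{j−1} for 1 < j ≤ s, σ(h_1) = g_1, and σ(t) = t for every t ∉ [a,c]. Then w_0 = σ·v. -/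

import Mathlib

open scoped Classical

namespace BSDist

/-- The simple transposition `s i` (1-indexed): it swaps the values `i` and `i+1`
of `{1,…,n}`, i.e. the elements `i-1` and `i` of `Fin n`.  Out-of-range letters
give the identity. -/
def sTr (n : ℕ) (i : ℕ) : Equiv.Perm (Fin n) :=
  if h : 1 ≤ i ∧ i < n then Equiv.swap ⟨i - 1, by omega⟩ ⟨i, h.2⟩ else 1

/-- The product `w(R) = s_{i₁} ⋯ s_{i_L}` of a word. -/
def wprod (n : ℕ) (R : List ℕ) : Equiv.Perm (Fin n) := (R.map (sTr n)).prod

/-- The Coxeter length of a permutation: its number of inversions. -/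
def len {n : ℕ} (w : Equiv.Perm (Fin n)) : ℕ :=
  (Finset.univ.filter (fun p : Fin n × Fin n => p.1 < p.2 ∧ w p.2 < w p.1)).card

/-- A word over the alphabet `{1,…,n-1}`. -/
def Alphabet (n : ℕ) (R : List ℕ) : Prop := ∀ i ∈ R, 1 ≤ i ∧ i < n

/-- `R` is a reduced word (over the alphabet `{1,…,n-1}`). -/
def IsReducedWord (n : ℕ) (R : List ℕ) : Prop :=
  Alphabet n R ∧ R.length = len (wprod n R)

/-- `R` is a reduced word for `w`. -/
def IsReducedWordFor (n : ℕ) (R : List ℕ) (w : Equiv.Perm (Fin n)) : Prop :=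
  IsReducedWord n R ∧ wprod n R = w

/-- The weight `wt_R : S_n → ℤ[q]`, defined by the recursion
`wt_∅(e) = 1`, `wt_∅(x) = 0` for `x ≠ e`, and for an appended letter `i`:
`wt_{Ri}(x) = wt_R(x) + wt_R(x sᵢ)` if `ℓ(x sᵢ) > ℓ(x)`, and
`wt_{Ri}(x) = q·wt_R(x) + q·wt_R(x sᵢ)` if `ℓ(x sᵢ) < ℓ(x)`. -/
noncomputable def wt (n : ℕ) (R : List ℕ) : Equiv.Perm (Fin n) → Polynomial ℤ :=
  R.foldl
    (fun f i x =>
      if len x < len (x * sTr n i) then f x + f (x * sTr n i)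
      else Polynomial.X * f x + Polynomial.X * f (x * sTr n i))
    (fun x => if x = 1 then 1 else 0)

/-- A single commutation move: replace a consecutive factor `ij` by `ji` where
`|i - j| > 1`. -/
def CommMove (R R' : List ℕ) : Prop :=
  ∃ (A B : List ℕ) (i j : ℕ), (i + 1 < j ∨ j + 1 < i) ∧
    R = A ++ [i, j] ++ B ∧ R' = A ++ [j, i] ++ B

/-- Commutation equivalence: a finite sequence of commutation moves. -/
def CommEquiv (R R' : List ℕ) : Prop := Relation.ReflTransGen CommMove R R'

/-- A single braid move: replace a consecutive factor `k(k+1)k` by `(k+1)k(k+1)`. -/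
def BraidMove (R R' : List ℕ) : Prop :=
  ∃ (A B : List ℕ) (k : ℕ),
    R = A ++ [k, k + 1, k] ++ B ∧ R' = A ++ [k + 1, k, k + 1] ++ B

/-- The Demazure product of a word, computed left to right:
`w ∗ sᵢ = w sᵢ` if `ℓ(w sᵢ) > ℓ(w)`, and `w ∗ sᵢ = w` otherwise. -/
def dem (n : ℕ) (R : List ℕ) : Equiv.Perm (Fin n) :=
  R.foldl (fun w i => if len w < len (w * sTr n i) then w * sTr n i else w) 1

/-- `app w t` is the value `w(t)` in 1-indexed one-line notation:
positions and values both run through `{1,…,n}`. -/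
def app {n : ℕ} (w : Equiv.Perm (Fin n)) (t : ℕ) : ℕ :=
  if h : 1 ≤ t ∧ t ≤ n then ((w ⟨t - 1, by omega⟩ : Fin n) : ℕ) + 1 else 0

/-- `posOf x t = x⁻¹(t)`, the (1-indexed) position of the value `t` in `x`. -/
def posOf {n : ℕ} (x : Equiv.Perm (Fin n)) (t : ℕ) : ℕ := app x⁻¹ t

/-- The longest element `w₀` of `S_n` (the order-reversing permutation). -/
def w0 (n : ℕ) : Equiv.Perm (Fin n) := ⟨Fin.rev, Fin.rev, Fin.rev_rev, Fin.rev_rev⟩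

/-- The value pair `(a,b)` (with `a < b`) is an inversion of `x`:
`x⁻¹(a) > x⁻¹(b)`. -/
def IsInversion {n : ℕ} (x : Equiv.Perm (Fin n)) (a b : ℕ) : Prop :=
  posOf x b < posOf x a

/-- `tau R a b` is the first time `k` at which the pair `(a,b)` is an inversion
of the prefix product `s_{i₁} ⋯ s_{i_k}`. -/
noncomputable def tau (n : ℕ) (R : List ℕ) (a b : ℕ) : ℕ :=
  sInf {k | IsInversion (wprod n (R.take k)) a b}

/-- `T_R(a,b,c) = +1` if `τ_R(a,b) < τ_R(b,c)` and `-1` otherwise. -/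
noncomputable def T (n : ℕ) (R : List ℕ) (a b c : ℕ) : ℤ :=
  if tau n R a b < tau n R b c then 1 else -1

/-- `Supp(x) = {t : pos_x(t) ≠ pos_{w₀}(t)}`. -/
noncomputable def Supp (n : ℕ) (x : Equiv.Perm (Fin n)) : Finset ℕ :=
  (Finset.Icc 1 n).filter (fun t => posOf x t ≠ posOf (w0 n) t)

/-- `Fwd(x) = {t : pos_x(t) < pos_{w₀}(t)}`. -/
noncomputable def Fwd (n : ℕ) (x : Equiv.Perm (Fin n)) : Finset ℕ :=
  (Finset.Icc 1 n).filter (fun t => posOf x t < posOf (w0 n) t)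

/-- `Bwd(x) = {t : pos_x(t) > pos_{w₀}(t)}`. -/
noncomputable def Bwd (n : ℕ) (x : Equiv.Perm (Fin n)) : Finset ℕ :=
  (Finset.Icc 1 n).filter (fun t => posOf (w0 n) t < posOf x t)

/-- `D_R(x)`: the coefficient of `q^{N-1}` in `wt_R(x)`, where `N = n(n-1)/2`. -/
noncomputable def D (n : ℕ) (R : List ℕ) (x : Equiv.Perm (Fin n)) : ℤ :=
  (wt n R x).coeff (n * (n - 1) / 2 - 1)

/-- `σ_b(x) = sign(pos_x(b) − pos_{w₀}(b)) ∈ {−1,0,+1}`. -/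
noncomputable def sigmaVal (n : ℕ) (b : ℕ) (x : Equiv.Perm (Fin n)) : ℤ :=
  Int.sign ((posOf x b : ℤ) - (posOf (w0 n) b : ℤ))

/-- `Θ_R(a,b,c) = Σ_{x : Supp(x) = [a,c]} D_R(x)·σ_b(x)`. -/
noncomputable def Theta (n : ℕ) (R : List ℕ) (a b c : ℕ) : ℤ :=
  ∑ x ∈ Finset.univ.filter (fun x : Equiv.Perm (Fin n) => Supp n x = Finset.Icc a c),
    D n R x * sigmaVal n b x

end BSDist

namespace BSDist


/-- Invariant of the coupled process: `y` is encoded by the relation `L` (left of). -/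
structure CInv {n : ℕ} (a c : Fin n) (Af Bf : Fin n → Prop) (L : Fin n → Fin n → Prop)
    (ρ : Fin n → Fin n) (A B : Fin n → Prop) : Prop where
  hAf : ∀ t, A t → Af t
  hBf : ∀ t, B t → Bf t
  hAa : A a
  hBc : B c
  dn : ∀ t, (A t ∧ t ≠ a ∨ t = c) → A (ρ t) ∧ ρ t < t ∧ ∀ s, A s → s < t → s ≤ ρ t
  up : ∀ t, (B t ∧ t ≠ c ∨ t = a) → B (ρ t) ∧ t < ρ t ∧ ∀ s, B s → t < s → ρ t ≤ s
  fx : ∀ t, ¬ A t → ¬ B t → ρ t = t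
  inv : ∀ t s, (Af t ∧ t ≠ a ∨ t = c) → (Bf s ∧ s ≠ c ∨ s = a) → s < t → L t s
  la : ∀ t g, Af t → ¬ A t → (A g ∨ g = c) → t < g → ρ g < t → L t g
  lb : ∀ t h, Bf t → ¬ B t → (B h ∨ h = a) → h < t → t < ρ h → L h t

section step
variable {n : ℕ} {a c : Fin n} {Af Bf : Fin n → Prop} {L L' : Fin n → Fin n → Prop}
    {ρ ρ' : Fin n → Fin n} {A B : Fin n → Prop} {p q : Fin n}

theorem CInv.stepSame (hac : a < c) (H : CInv a c Af Bf L ρ A B)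
    (hd : ∀ t, Af t → ¬ Bf t)
    (hpq : p < q) (hL' : ∀ s t, L s t → ¬ (s = p ∧ t = q) → L' s t)
    (hlt : ρ p < ρ q) : CInv a c Af Bf L' ρ A B := by
  obtain ⟨h1, h2, h3, h4, h5, h6, h7, h8, h9, h10⟩ := H
  refine ⟨h1, h2, h3, h4, h5, h6, h7, ?_, ?_, ?_⟩
  · intro t s ht hs hst
    refine hL' _ _ (h8 t s ht hs hst) ?_
    rintro ⟨rfl, rfl⟩
    exact absurd hpq (not_lt.2 hst.le)
  · intro t g ht hA hg htg hr
    refine hL' _ _ (h9 t g ht hA hg htg hr) ?_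
    rintro ⟨rfl, rfl⟩
    have := h7 t hA (fun hb => hd t ht (h2 t hb))
    rw [this] at hlt
    exact absurd hlt (not_lt.2 hr.le)
  · intro t g ht hA hg htg hr
    refine hL' _ _ (h10 t g ht hA hg htg hr) ?_
    rintro ⟨rfl, rfl⟩
    have := h7 t (fun hb => hd t (h1 t hb) ht) hA
    rw [this] at hlt
    exact absurd hlt (not_lt.2 hr.le)

theorem CInv.cases (hac : a < c) (H : CInv a c Af Bf L ρ A B)
    (hd : ∀ t, Af t → ¬ Bf t) (hcov : ∀ t, (Af t ∨ Bf t) ↔ (a ≤ t ∧ t ≤ c))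
    (hpq : p < q) (hLqp : ¬ L q p) (hlt : ρ q < ρ p) :
    (Af p ∧ ¬ A p ∧ (A q ∨ q = c) ∧ ρ q < p) ∨ (Bf q ∧ ¬ B q ∧ (B p ∨ p = a) ∧ q < ρ p) := by
  obtain ⟨h1, h2, h3, h4, h5, h6, h7, h8, h9, h10⟩ := H
  have hAa := h1 a h3
  have hBc := h2 c h4
  have inv' := fun x y => hLqp ∘ (fun z => h8 q p x y z)
  have hp7 := h7 p
  have hq7 := h7 q
  have hp5 := h5 p
  have hq5 := h5 q
  have hp6 := h6 p
  have hq6 := h6 q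
  have := hcov p
  have := hcov q
  have := h1 p
  have := h1 q
  have := h2 p
  have := h2 q
  have := hd p
  have := hd q
  have e1 : A p → ¬ B p := fun h h' => hd p (h1 p h) (h2 p h')
  have e2 : A q → ¬ B q := fun h h' => hd q (h1 q h) (h2 q h')
  have r1 := hcov (ρ p)
  have r2 := hcov (ρ q)
  have r3 := h1 (ρ p)
  have r4 := h1 (ρ q)
  have r5 := h2 (ρ p)
  have r6 := h2 (ρ q)
  by_cases hq : A q ∧ q ≠ a ∨ q = c
  · have hp' : ¬ (Bf p ∧ p ≠ c ∨ p = a) := fun h => hLqp (h8 q p (by grind) h hpq)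
    by_cases hp : A p ∧ p ≠ a ∨ p = c
    · grind
    · grind
  · by_cases hp : B p ∧ p ≠ c ∨ p = a
    · by_cases hq' : B q ∧ q ≠ c ∨ q = a
      · grind
      · grind
    · grind

theorem CInv.stepA (hac : a < c) (H : CInv a c Af Bf L ρ A B)
    (hd : ∀ t, Af t → ¬ Bf t) (hcov : ∀ t, (Af t ∨ Bf t) ↔ (a ≤ t ∧ t ≤ c))
    (hpq : p < q) (hL' : ∀ s t, L s t → ¬ (s = p ∧ t = q) → L' s t)
    (hadj : ∀ t, t ≠ p → t ≠ q → L t q → L t p)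
    (hp : ρ' p = ρ q) (hq : ρ' q = ρ p) (hr : ∀ t, t ≠ p → t ≠ q → ρ' t = ρ t)
    (k1 : Af p) (k2 : ¬ A p) (k3 : A q ∨ q = c) (k4 : ρ q < p) :
    CInv a c Af Bf L' ρ' (fun t => A t ∨ t = p) B := by
  obtain ⟨h1, h2, h3, h4, h5, h6, h7, h8, h9, h10⟩ := H
  have hAa := h1 a h3
  have hBc := h2 c h4
  have hpp : ρ p = p := h7 p k2 (fun hb => hd p k1 (h2 p hb))
  rw [hpp] at hq
  have cp := hcov p
  have hpa : p ≠ a := by grind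
  have hpc : p ≠ c := by grind
  have hqa : q ≠ a := by grind
  refine ⟨?_, h2, Or.inl h3, h4, ?_, ?_, ?_, ?_, ?_, ?_⟩
  · grind
  · intro t ht
    have q5 := h5 q (by grind)
    by_cases e1 : t = p
    · subst e1
      rw [hp]
      grind
    · by_cases e2 : t = q
      · subst e2
        rw [hq]
        grind
      · rw [hr t e1 e2]
        have t5 := h5 t (by grind)
        refine ⟨Or.inl t5.1, t5.2.1, ?_⟩
        rintro s (hs | rfl) hst
        · exact t5.2.2 s hs hst
        · by_contra hcon
          push Not at hcon
          grind
  · intro t ht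
    have : t ≠ p := by grind
    have : t ≠ q := by grind
    rw [hr t ‹_› ‹_›]
    exact h6 t ht
  · grind
  · intro t s ht hs hst
    refine hL' _ _ (h8 t s ht hs hst) ?_
    rintro ⟨rfl, rfl⟩
    exact absurd hpq (not_lt.2 hst.le)
  · intro t g ht hA hg htg hr'
    have htp : t ≠ p := fun h => hA (Or.inr h)
    have htA : ¬ A t := fun h => hA (Or.inl h)
    refine hL' _ _ ?_ (fun h => htp h.1)
    by_cases e1 : g = p
    · subst e1
      rw [hp] at hr'
      have : t ≠ q := by grind
      exact hadj t htp this (h9 t q ht htA k3 (htg.trans hpq) hr')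
    · by_cases e2 : g = q
      · subst e2
        rw [hq] at hr'
        exact h9 t g ht htA k3 htg (k4.trans hr')
      · rw [hr g e1 e2] at hr'
        exact h9 t g ht htA (by grind) htg hr'
  · intro t h ht hB hh hht hr'
    have ct := hcov t
    have e1 : h ≠ p := by grind
    have e2 : h ≠ q := by grind
    rw [hr h e1 e2] at hr'
    exact hL' _ _ (h10 t h ht hB hh hht hr') (fun z => e1 z.1)

theorem CInv.stepB (hac : a < c) (H : CInv a c Af Bf L ρ A B)
    (hd : ∀ t, Af t → ¬ Bf t) (hcov : ∀ t, (Af t ∨ Bf t) ↔ (a ≤ t ∧ t ≤ c))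
    (hpq : p < q) (hL' : ∀ s t, L s t → ¬ (s = p ∧ t = q) → L' s t)
    (hadj : ∀ t, t ≠ p → t ≠ q → L p t → L q t)
    (hp : ρ' p = ρ q) (hq : ρ' q = ρ p) (hr : ∀ t, t ≠ p → t ≠ q → ρ' t = ρ t)
    (k1 : Bf q) (k2 : ¬ B q) (k3 : B p ∨ p = a) (k4 : q < ρ p) :
    CInv a c Af Bf L' ρ' A (fun t => B t ∨ t = q) := by
  obtain ⟨h1, h2, h3, h4, h5, h6, h7, h8, h9, h10⟩ := H
  have hAa := h1 a h3
  have hBc := h2 c h4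
  have hpp : ρ q = q := h7 q (fun hb => hd q (h1 q hb) k1) k2
  rw [hpp] at hp
  have cp := hcov q
  have hqa : q ≠ a := by grind
  have hqc : q ≠ c := by grind
  have hpc : p ≠ c := by grind
  refine ⟨h1, ?_, h3, Or.inl h4, ?_, ?_, ?_, ?_, ?_, ?_⟩
  · grind
  · intro t ht
    have : t ≠ p := by grind
    have : t ≠ q := by grind
    rw [hr t ‹_› ‹_›]
    exact h5 t ht
  · intro t ht
    have p6 := h6 p (by grind)
    by_cases e1 : t = q
    · subst e1
      rw [hq]
      grind
    · by_cases e2 : t = p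
      · subst e2
        rw [hp]
        grind
      · rw [hr t e2 e1]
        have t6 := h6 t (by grind)
        refine ⟨Or.inl t6.1, t6.2.1, ?_⟩
        rintro s (hs | rfl) hst
        · exact t6.2.2 s hs hst
        · by_contra hcon
          push Not at hcon
          grind
  · grind
  · intro t s ht hs hst
    refine hL' _ _ (h8 t s ht hs hst) ?_
    rintro ⟨rfl, rfl⟩
    exact absurd hpq (not_lt.2 hst.le)
  · intro t g ht hA hg htg hr'
    have ct := hcov t
    have : g ≠ p := by grind
    have : g ≠ q := by grind
    rw [hr g ‹_› ‹_›] at hr'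
    exact hL' _ _ (h9 t g ht hA hg htg hr') (fun z => this z.2)
  · intro t h ht hB hh hht hr'
    have htq : t ≠ q := fun h => hB (Or.inr h)
    have htB : ¬ B t := fun h => hB (Or.inl h)
    refine hL' _ _ ?_ (fun h => htq h.2)
    by_cases e1 : h = q
    · subst e1
      rw [hq] at hr'
      have : t ≠ p := by grind
      exact hadj t this htq (h10 t p ht htB k3 (hpq.trans hht) hr')
    · by_cases e2 : h = p
      · subst e2
        rw [hp] at hr'
        exact h10 t h ht htB k3 hht (hr'.trans k4)
      · rw [hr h e2 e1] at hr'
        exact h10 t h ht htB (by grind) hht hr'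

theorem CInv.final (H : CInv a c Af Bf L ρ A B)
    (hd : ∀ t, Af t → ¬ Bf t) (hcov : ∀ t, (Af t ∨ Bf t) ↔ (a ≤ t ∧ t ≤ c))
    (hL : ∀ s t, s < t → ¬ L s t) : (∀ t, A t ↔ Af t) ∧ (∀ t, B t ↔ Bf t) := by
  obtain ⟨h1, h2, h3, h4, h5, h6, h7, h8, h9, h10⟩ := H
  have hAa := h1 a h3
  have hBc := h2 c h4
  constructor
  · refine fun t => ⟨h1 t, fun ht => ?_⟩
    by_contra hA
    have ct := (hcov t).1 (Or.inl ht)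
    have htc : t < c := lt_of_le_of_ne ct.2 (by grind)
    obtain ⟨g, hg, hmin⟩ := Finset.exists_min_image
      (Finset.univ.filter (fun g => (A g ∨ g = c) ∧ t < g)) id ⟨c, by simp [htc]⟩
    simp only [Finset.mem_filter, Finset.mem_univ, true_and, id] at hg hmin
    have g5 := h5 g (by grind)
    refine hL t g hg.2 (h9 t g ht hA hg.1 hg.2 ?_)
    by_contra hcon
    have := hmin (ρ g)
    grind
  · refine fun t => ⟨h2 t, fun ht => ?_⟩
    by_contra hB
    have ct := (hcov t).1 (Or.inr ht)
    have hta : a < t := lt_of_le_of_ne ct.1 (by grind)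
    obtain ⟨g, hg, hmax⟩ := Finset.exists_max_image
      (Finset.univ.filter (fun g => (B g ∨ g = a) ∧ g < t)) id ⟨a, by simp [hta]⟩
    simp only [Finset.mem_filter, Finset.mem_univ, true_and, id] at hg hmax
    have g6 := h6 g (by grind)
    refine hL g t hg.2 (h10 t g ht hB hg.1 hg.2 ?_)
    by_contra hcon
    have := hmax (ρ g)
    grind

end step

theorem len_swap_asc {n : ℕ} (w : Equiv.Perm (Fin n)) (P Q : Fin n) (h : Q.val = P.val + 1)
    (hw : w P < w Q) : len (w * Equiv.swap P Q) = len w + 1 := by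
  have hPQ : P < Q := by rw [Fin.lt_def]; omega
  unfold len
  set S := Finset.univ.filter (fun p : Fin n × Fin n => p.1 < p.2 ∧ w p.2 < w p.1)
  have key : (Finset.univ.filter (fun p : Fin n × Fin n => p.1 < p.2 ∧
      (w * Equiv.swap P Q) p.2 < (w * Equiv.swap P Q) p.1)) =
      insert (P, Q) (S.map ((Equiv.prodCongr (Equiv.swap P Q) (Equiv.swap P Q)).toEmbedding)) := by
    ext ⟨x, y⟩
    simp only [Finset.mem_filter, Finset.mem_univ, true_and, Finset.mem_insert,
      Finset.mem_map_equiv, S, Equiv.prodCongr_symm, Equiv.symm_swap, Equiv.prodCongr_apply,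
      Prod.map, Equiv.Perm.mul_apply, Prod.mk.injEq]
    simp only [Equiv.swap_apply_def]
    split_ifs <;> grind
  rw [key, Finset.card_insert_of_notMem, Finset.card_map]
  simp only [Finset.mem_map_equiv, S, Equiv.prodCongr_symm, Equiv.symm_swap,
    Equiv.prodCongr_apply, Prod.map, Finset.mem_filter, Equiv.swap_apply_left,
    Equiv.swap_apply_right]
  grind

theorem len_swap_iff {n : ℕ} (w : Equiv.Perm (Fin n)) (P Q : Fin n) (h : Q.val = P.val + 1) :
    len w < len (w * Equiv.swap P Q) ↔ w P < w Q := by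
  constructor
  · intro hl
    by_contra hcon
    have hPQ : P ≠ Q := by intro e; subst e; omega
    have : w Q < w P := lt_of_le_of_ne (not_lt.1 hcon) (fun e => hPQ (w.injective e).symm)
    have := len_swap_asc (w * Equiv.swap P Q) P Q h (by simpa using this)
    rw [mul_assoc, Equiv.swap_mul_self, mul_one] at this
    omega
  · intro hw
    rw [len_swap_asc w P Q h hw]
    omega

theorem len_swap_le {n : ℕ} (w : Equiv.Perm (Fin n)) (P Q : Fin n) (h : Q.val = P.val + 1) :
    len (w * Equiv.swap P Q) ≤ len w + 1 := by
  by_cases hw : w P < w Q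
  · exact (len_swap_asc w P Q h hw).le
  · have := mt (len_swap_iff w P Q h).1 hw
    omega

theorem len_sTr_le {n : ℕ} (w : Equiv.Perm (Fin n)) (i : ℕ) : len (w * sTr n i) ≤ len w + 1 := by
  unfold sTr
  split_ifs with h
  · exact len_swap_le w _ _ (by simp; omega)
  · simp

theorem wprod_append (n : ℕ) (R S : List ℕ) : wprod n (R ++ S) = wprod n R * wprod n S := by
  simp [wprod]

theorem wprod_cons (n : ℕ) (i : ℕ) (S : List ℕ) : wprod n (i :: S) = sTr n i * wprod n S := by
  simp [wprod]

theorem len_mul_wprod_le {n : ℕ} (S : List ℕ) (w : Equiv.Perm (Fin n)) :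
    len (w * wprod n S) ≤ len w + S.length := by
  induction S generalizing w with
  | nil => simp [wprod]
  | cons j S ih =>
    rw [wprod_cons, ← mul_assoc]
    have := ih (w * sTr n j)
    have := len_sTr_le w j
    simp only [List.length_cons]
    omega

theorem len_one (n : ℕ) : len (1 : Equiv.Perm (Fin n)) = 0 := by
  unfold len
  rw [Finset.card_eq_zero, Finset.filter_eq_empty_iff]
  rintro ⟨x, y⟩ -
  simp only [Equiv.Perm.one_apply]
  rintro ⟨h, h'⟩
  exact absurd h (not_lt.2 h'.le)

/-- Every step along a reduced word is ascending. -/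
def Asc (n : ℕ) : Equiv.Perm (Fin n) → List ℕ → Prop
  | _, [] => True
  | w, j :: S => len w < len (w * sTr n j) ∧ Asc n (w * sTr n j) S

theorem asc_of_len {n : ℕ} (S : List ℕ) (w : Equiv.Perm (Fin n))
    (h : len (w * wprod n S) = len w + S.length) : Asc n w S := by
  induction S generalizing w with
  | nil => trivial
  | cons j S ih =>
    rw [wprod_cons, ← mul_assoc] at h
    have h1 := len_mul_wprod_le S (w * sTr n j)
    have h2 := len_sTr_le w j
    simp only [List.length_cons] at h
    exact ⟨by omega, ih _ (by omega)⟩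

theorem asc_append {n : ℕ} (S T : List ℕ) (w : Equiv.Perm (Fin n)) (h : Asc n w (S ++ T)) :
    Asc n w S ∧ Asc n (w * wprod n S) T := by
  induction S generalizing w with
  | nil => simpa [wprod, Asc] using h
  | cons j S ih =>
    obtain ⟨h1, h2⟩ := h
    have := ih _ h2
    rw [wprod_cons, ← mul_assoc]
    exact ⟨⟨h1, this.1⟩, this.2⟩

/-- One Demazure step. -/
noncomputable def demStep (n : ℕ) (w : Equiv.Perm (Fin n)) (i : ℕ) : Equiv.Perm (Fin n) :=
  if len w < len (w * sTr n i) then w * sTr n i else w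

theorem dem_eq (n : ℕ) (R : List ℕ) : dem n R = R.foldl (demStep n) 1 := by
  unfold dem demStep
  congr

theorem foldl_asc {n : ℕ} (S : List ℕ) (w : Equiv.Perm (Fin n)) (h : Asc n w S) :
    S.foldl (demStep n) w = w * wprod n S := by
  induction S generalizing w with
  | nil => simp [wprod]
  | cons j S ih =>
    obtain ⟨h1, h2⟩ := h
    rw [List.foldl_cons, wprod_cons, ← mul_assoc, ← ih _ h2]
    simp [demStep, h1]

/-- The left-of relation on values of `y`. -/
def leftOf {n : ℕ} (y : Equiv.Perm (Fin n)) (s t : Fin n) : Prop := y⁻¹ s < y⁻¹ t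

theorem run {n : ℕ} {a c : Fin n} {Af Bf : Fin n → Prop} (hac : a < c)
    (hd : ∀ t, Af t → ¬ Bf t) (hcov : ∀ t, (Af t ∨ Bf t) ↔ (a ≤ t ∧ t ≤ c))
    (S : List ℕ) (x y : Equiv.Perm (Fin n)) (A B : Fin n → Prop)
    (hS : Asc n y S) (H : CInv a c Af Bf (leftOf y) (fun t => x (y⁻¹ t)) A B) :
    ∃ A' B', CInv a c Af Bf (leftOf (y * wprod n S))
      (fun t => (S.foldl (demStep n) x) ((y * wprod n S)⁻¹ t)) A' B' := by
  induction S generalizing x y A B with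
  | nil => exact ⟨A, B, by simpa [wprod] using H⟩
  | cons j S ih =>
    obtain ⟨h1, h2⟩ := hS
    rw [List.foldl_cons, wprod_cons, ← mul_assoc]
    suffices hh : ∃ A' B', CInv a c Af Bf (leftOf (y * sTr n j))
        (fun t => (demStep n x j) ((y * sTr n j)⁻¹ t)) A' B' by
      obtain ⟨A', B', h⟩ := hh
      exact ih _ _ A' B' h2 h
    clear ih h2
    have hj : 1 ≤ j ∧ j < n := by
      by_contra hcon
      simp [sTr, hcon] at h1
    unfold demStep
    have hs : sTr n j = Equiv.swap ⟨j - 1, by omega⟩ ⟨j, hj.2⟩ := by simp [sTr, hj]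
    rw [hs] at h1 ⊢
    generalize hP : (⟨j - 1, by omega⟩ : Fin n) = P at *
    generalize hQ : (⟨j, hj.2⟩ : Fin n) = Q at *
    have hPQ : Q.val = P.val + 1 := by subst hP hQ; simp; omega
    clear hs hP hQ hj
    rw [len_swap_iff _ _ _ hPQ] at h1
    have hxi := len_swap_iff x _ _ hPQ
    obtain ⟨p, hp⟩ : ∃ p, p = y P := ⟨_, rfl⟩
    obtain ⟨q, hq⟩ : ∃ q, q = y Q := ⟨_, rfl⟩
    have hpq : p < q := by rw [hp, hq]; exact h1
    have hp' : y⁻¹ p = P := by simp [hp]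
    have hq' : y⁻¹ q = Q := by simp [hq]
    have hne : ∀ t, t ≠ p → y⁻¹ t ≠ P := by
      intro t ht h; apply ht; rw [hp, ← h]; simp
    have hne' : ∀ t, t ≠ q → y⁻¹ t ≠ Q := by
      intro t ht h; apply ht; rw [hq, ← h]; simp
    have hinv : ∀ t, (y * Equiv.swap P Q)⁻¹ t = Equiv.swap P Q (y⁻¹ t) := by
      intro t; simp
    have hL' : ∀ s t, leftOf y s t → ¬ (s = p ∧ t = q) →
        leftOf (y * Equiv.swap P Q) s t := by
      intro s t hst hn
      unfold leftOf at *
      rw [hinv, hinv]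
      have e1 := hne s
      have e2 := hne' s
      have e3 := hne t
      have e4 := hne' t
      simp only [Equiv.swap_apply_def]
      split_ifs <;> grind
    have hadj1 : ∀ t, t ≠ p → t ≠ q → leftOf y t q → leftOf y t p := by
      intro t ht ht' h
      have e1 := hne t ht
      unfold leftOf at *
      rw [hq'] at h
      rw [hp']
      grind
    have hadj2 : ∀ t, t ≠ p → t ≠ q → leftOf y p t → leftOf y q t := by
      intro t ht ht' h
      have e1 := hne' t ht'
      unfold leftOf at *
      rw [hp'] at h
      rw [hq']
      grind
    by_cases hx : x P < x Q
    · rw [if_pos (hxi.2 hx)]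
      refine ⟨A, B, ?_⟩
      have : (fun t => (x * Equiv.swap P Q) ((y * Equiv.swap P Q)⁻¹ t)) =
          (fun t => x (y⁻¹ t)) := by
        funext t
        rw [hinv]; simp
      rw [this]
      exact H.stepSame hac hd hpq hL' (by simpa only [hp', hq'] using hx)
    · rw [if_neg (fun h => hx (hxi.1 h))]
      have hPQ' : P ≠ Q := by intro e; subst e; omega
      have hx' : x Q < x P := lt_of_le_of_ne (not_lt.1 hx) (fun e => hPQ' (x.injective e).symm)
      have hLqp : ¬ leftOf y q p := by
        unfold leftOf; rw [hp', hq']; grind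
      have r1 : (fun t => x ((y * Equiv.swap P Q)⁻¹ t)) p = (fun t => x (y⁻¹ t)) q := by
        simp only [hinv, hp', hq', Equiv.swap_apply_left]
      have r2 : (fun t => x ((y * Equiv.swap P Q)⁻¹ t)) q = (fun t => x (y⁻¹ t)) p := by
        simp only [hinv, hp', hq', Equiv.swap_apply_right]
      have r3 : ∀ t, t ≠ p → t ≠ q →
          (fun t => x ((y * Equiv.swap P Q)⁻¹ t)) t = (fun t => x (y⁻¹ t)) t := by
        intro t ht ht'
        simp only [hinv]
        rw [Equiv.swap_apply_of_ne_of_ne (hne t ht) (hne' t ht')]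
      rcases H.cases hac hd hcov hpq hLqp (by simpa only [hp', hq'] using hx') with
        ⟨k1, k2, k3, k4⟩ | ⟨k1, k2, k3, k4⟩
      · exact ⟨_, _, H.stepA hac hd hcov hpq hL' hadj1 r1 r2 r3 k1 k2 k3 k4⟩
      · exact ⟨_, _, H.stepB hac hd hcov hpq hL' hadj2 r1 r2 r3 k1 k2 k3 k4⟩

theorem startInv {n : ℕ} (u : Equiv.Perm (Fin n)) (P Q R : Fin n) (hPQ : Q.val = P.val + 1)
    (hQR : R.val = Q.val + 1) (h1 : u P < u Q) (h2 : u Q < u R) :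
    CInv (u P) (u R) (fun t => u P ≤ t ∧ t ≤ u R ∧ u⁻¹ t ≤ Q)
      (fun t => u P ≤ t ∧ t ≤ u R ∧ R ≤ u⁻¹ t)
      (leftOf (u * Equiv.swap P R))
      (fun t => (u * Equiv.swap P Q) ((u * Equiv.swap P R)⁻¹ t))
      (fun t => t = u P ∨ t = u Q) (fun t => t = u R) := by
  have n1 : P < Q := by grind
  have n2 : Q < R := by grind
  have hinv : ∀ t, (u * Equiv.swap P R)⁻¹ t = Equiv.swap P R (u⁻¹ t) := by
    intro t; simp
  have i1 : u⁻¹ (u P) = P := by simp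
  have i2 : u⁻¹ (u Q) = Q := by simp
  have i3 : u⁻¹ (u R) = R := by simp
  have v1 : ∀ t, t ≠ u P → u⁻¹ t ≠ P := by
    intro t ht h; apply ht; rw [← h]; simp
  have v2 : ∀ t, t ≠ u Q → u⁻¹ t ≠ Q := by
    intro t ht h; apply ht; rw [← h]; simp
  have v3 : ∀ t, t ≠ u R → u⁻¹ t ≠ R := by
    intro t ht h; apply ht; rw [← h]; simp
  have r1 : (u * Equiv.swap P Q) (Equiv.swap P R (u⁻¹ (u P))) = u R := by
    rw [i1, Equiv.swap_apply_left, Equiv.Perm.mul_apply,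
      Equiv.swap_apply_of_ne_of_ne (n1.trans n2).ne' n2.ne']
  have r2 : (u * Equiv.swap P Q) (Equiv.swap P R (u⁻¹ (u Q))) = u P := by
    rw [i2, Equiv.swap_apply_of_ne_of_ne n1.ne' n2.ne, Equiv.Perm.mul_apply,
      Equiv.swap_apply_right]
  have r3 : (u * Equiv.swap P Q) (Equiv.swap P R (u⁻¹ (u R))) = u Q := by
    rw [i3, Equiv.swap_apply_right, Equiv.Perm.mul_apply, Equiv.swap_apply_left]
  simp only [hinv]
  constructor
  · rintro t (rfl | rfl)
    · exact ⟨le_rfl, (h1.trans h2).le, by rw [i1]; exact n1.le⟩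
    · exact ⟨h1.le, h2.le, by rw [i2]⟩
  · rintro t rfl
    exact ⟨(h1.trans h2).le, le_rfl, by rw [i3]⟩
  · exact Or.inl rfl
  · rfl
  · rintro t (⟨rfl | rfl, ht⟩ | rfl)
    · exact absurd rfl ht
    · rw [r2]; grind
    · rw [r3]; grind
  · rintro t (⟨rfl, ht⟩ | rfl)
    · exact absurd rfl ht
    · rw [r1]; grind
  · intro t ht ht'
    push Not at ht
    have w1 := v1 t ht.1
    have w2 := v2 t ht.2
    have w3 := v3 t ht'
    rw [Equiv.swap_apply_of_ne_of_ne w1 w3, Equiv.Perm.mul_apply,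
      Equiv.swap_apply_of_ne_of_ne w1 w2]
    simp
  · intro t s ht hs hst
    unfold leftOf
    rw [hinv, hinv]
    have w1 := v1 t
    have w3 := v3 t
    have w4 := v1 s
    have w6 := v3 s
    simp only [Equiv.swap_apply_def]
    split_ifs <;> grind
  · intro t g ht hA hg htg hr
    unfold leftOf
    rw [hinv, hinv]
    push Not at hA
    have w1 := v1 t hA.1
    have w2 := v2 t hA.2
    simp only [Equiv.swap_apply_def]
    split_ifs <;> grind
  · intro t g ht hA hg htg hr
    unfold leftOf
    rw [hinv, hinv]
    have w3 := v3 t hA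
    simp only [Equiv.swap_apply_def]
    split_ifs <;> grind


theorem app_succ {n : ℕ} (w : Equiv.Perm (Fin n)) (k : Fin n) :
    app w (k.val + 1) = (w k).val + 1 := by
  have : 1 ≤ k.val + 1 ∧ k.val + 1 ≤ n := ⟨by omega, k.2⟩
  simp [app, this]

/-- Let `R₁ = T₁·i(i+1)i·T₂` be a reduced word for the
longest element `w₀ ∈ S_n`, `u = w(T₁)`, `a = u(i)`, `b = u(i+1)`,
`c = u(i+2)`; then `a < b < c`.  Let `v = Dem(T₁·i·T₂)`,
`A = {u(j) : j ≤ i+1, u(j) ∈ [a,c]} = {a = g₁ < ⋯ < g_r}` and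
`B = {u(j) : j ≥ i+2, u(j) ∈ [a,c]} = {h₁ < ⋯ < h_s = c}`.  Then for the
cycle `σ = (g₁ g₂ ⋯ g_r h_s h_{s-1} ⋯ h₁)` (fixing everything outside
`[a,c]`) one has `w₀ = σ·v`.  The cycle is encoded by: `σ` sends each element
of `A` to its immediate successor in `A`, the maximum of `A` to `c`, each
element of `B` to its immediate predecessor in `B`, and the minimum of `B`
to `a`. -/
theorem cycle_description_of_demazure_shortening
    (n : ℕ) (hn : 2 ≤ n) (T₁ T₂ : List ℕ) (i : ℕ)
    (hi : 1 ≤ i ∧ i + 1 ≤ n - 1)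
    (hred : IsReducedWordFor n (T₁ ++ [i, i + 1, i] ++ T₂) (w0 n))
    (u : Equiv.Perm (Fin n)) (hu : u = wprod n T₁)
    (a b c : ℕ) (ha : a = app u i) (hb : b = app u (i + 1)) (hc : c = app u (i + 2))
    (v : Equiv.Perm (Fin n)) (hv : v = dem n (T₁ ++ [i] ++ T₂))
    (A B : Finset ℕ)
    (hA : A = (Finset.Icc 1 n).filter (fun t => a ≤ t ∧ t ≤ c ∧ posOf u t ≤ i + 1))
    (hB : B = (Finset.Icc 1 n).filter (fun t => a ≤ t ∧ t ≤ c ∧ i + 2 ≤ posOf u t)) :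
    a < b ∧ b < c ∧
    ∃ σ : Equiv.Perm (Fin n),
      (∀ t : ℕ, 1 ≤ t → t ≤ n → (t < a ∨ c < t) → app σ t = t) ∧
      (∀ t ∈ A, ∀ t' ∈ A, t < t' → (∀ s ∈ A, s ≤ t ∨ t' ≤ s) → app σ t = t') ∧
      (∀ t ∈ A, (∀ s ∈ A, s ≤ t) → app σ t = c) ∧
      (∀ t ∈ B, ∀ t' ∈ B, t' < t → (∀ s ∈ B, s ≤ t' ∨ t ≤ s) → app σ t = t') ∧
      (∀ t ∈ B, (∀ s ∈ B, t ≤ s) → app σ t = a) ∧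
      w0 n = σ * v := by
  obtain ⟨⟨halph, hlen⟩, hw⟩ := hred
  have hasc : Asc n 1 (T₁ ++ ([i] ++ ([i + 1, i] ++ T₂))) := by
    apply asc_of_len
    rw [one_mul, len_one, zero_add]
    simpa using hlen.symm
  obtain ⟨asc1, hasc⟩ := asc_append _ _ _ hasc
  rw [one_mul, ← hu] at hasc
  have hdem : v = T₂.foldl (demStep n) (u * sTr n i) := by
    rw [hv, dem_eq, List.foldl_append, List.foldl_append, foldl_asc _ _ asc1, one_mul, ← hu]
    simp [demStep, hasc.1]
  obtain ⟨g1, g2, g3, g4⟩ := hasc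
  have hi3 : i + 1 < n := by omega
  have hs1 : sTr n i = Equiv.swap ⟨i - 1, by omega⟩ ⟨i, by omega⟩ := by
    have : 1 ≤ i ∧ i < n := by omega
    simp [sTr, this]
  have hs2 : sTr n (i + 1) = Equiv.swap ⟨i, by omega⟩ ⟨i + 1, hi3⟩ := by
    simp [sTr, hi3]
  obtain ⟨P, hP⟩ : ∃ P : Fin n, P = ⟨i - 1, by omega⟩ := ⟨_, rfl⟩
  obtain ⟨Q, hQ⟩ : ∃ Q : Fin n, Q = ⟨i, by omega⟩ := ⟨_, rfl⟩
  obtain ⟨R, hR⟩ : ∃ R : Fin n, R = ⟨i + 1, hi3⟩ := ⟨_, rfl⟩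
  rw [← hP, ← hQ] at hs1
  rw [← hQ, ← hR] at hs2
  have vP : P.val + 1 = i := by rw [hP]; simp; omega
  have vQ : Q.val = i := by rw [hQ]
  have vR : R.val = i + 1 := by rw [hR]
  have hPQ : Q.val = P.val + 1 := by omega
  have hQR : R.val = Q.val + 1 := by omega
  have n1 : P ≠ Q := by intro e; rw [e] at hPQ; omega
  have n2 : Q ≠ R := by intro e; rw [e] at hQR; omega
  have n3 : P ≠ R := by intro e; rw [e] at hPQ; omega
  have ha' : a = (u P).val + 1 := by rw [ha, ← app_succ, vP]
  have hb' : b = (u Q).val + 1 := by rw [hb, ← app_succ, vQ]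
  have hc' : c = (u R).val + 1 := by rw [hc, ← app_succ, vR]
  rw [hs1] at g1 g2 g3 g4
  rw [hs2] at g2 g3 g4
  rw [len_swap_iff _ _ _ hPQ] at g1 g3
  rw [len_swap_iff _ _ _ hQR] at g2
  have k2 : u Q < u R := by
    simpa [Equiv.swap_apply_of_ne_of_ne n1 n3, Equiv.swap_apply_of_ne_of_ne n3.symm n2.symm]
      using g3
  have hbraid : u * Equiv.swap P Q * Equiv.swap Q R * Equiv.swap P Q = u * Equiv.swap P R := by
    rw [mul_assoc, mul_assoc]
    congr 1
    rw [← mul_assoc, Equiv.swap_comm P Q, Equiv.swap_comm Q R,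
      Equiv.swap_comm P R]
    ext t
    simp only [Equiv.Perm.mul_apply, Equiv.swap_apply_def]
    split_ifs <;> grind
  rw [hbraid] at g4
  have hfin : u * Equiv.swap P R * wprod n T₂ = w0 n := by
    rw [← hw, ← hbraid, hu, wprod_append, wprod_append]
    simp [wprod, hs1, hs2, mul_assoc]
  refine ⟨by rw [ha', hb']; simpa using g1, by rw [hb', hc']; simpa using k2, ?_⟩
  set Af : Fin n → Prop := fun t => u P ≤ t ∧ t ≤ u R ∧ u⁻¹ t ≤ Q with hAf
  set Bf : Fin n → Prop := fun t => u P ≤ t ∧ t ≤ u R ∧ R ≤ u⁻¹ t with hBf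
  have hd : ∀ t, Af t → ¬ Bf t := by
    intro t h1 h2
    have := h1.2.2.trans' h2.2.2
    rw [Fin.le_def] at this
    omega
  have hcov : ∀ t, (Af t ∨ Bf t) ↔ (u P ≤ t ∧ t ≤ u R) := by
    intro t
    simp only [hAf, hBf, Fin.le_def]
    omega
  have hac : u P < u R := g1.trans k2
  obtain ⟨A', B', H⟩ := run hac hd hcov T₂ (u * Equiv.swap P Q) (u * Equiv.swap P R) _ _ g4
    (startInv u P Q R hPQ hQR g1 k2)
  rw [hfin, ← hs1, ← hdem] at H
  obtain ⟨eA, eB⟩ := H.final hd hcov (by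
    intro s t hst h
    unfold leftOf at h
    have : ∀ t, (w0 n)⁻¹ t = Fin.rev t := fun t => rfl
    rw [this, this, Fin.rev_lt_rev] at h
    exact absurd h (not_lt.2 hst.le))
  have mA : ∀ k : Fin n, k.val + 1 ∈ A ↔ A' k := by
    intro k
    rw [eA, hA, Finset.mem_filter, Finset.mem_Icc, posOf, app_succ, ha', hc']
    simp only [hAf, Fin.le_def]
    omega
  have mB : ∀ k : Fin n, k.val + 1 ∈ B ↔ B' k := by
    intro k
    rw [eB, hB, Finset.mem_filter, Finset.mem_Icc, posOf, app_succ, ha', hc']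
    simp only [hBf, Fin.le_def]
    omega
  have lift1 : ∀ t : ℕ, 1 ≤ t → t ≤ n → ∃ k : Fin n, t = k.val + 1 :=
    fun t h1 h2 => ⟨⟨t - 1, by omega⟩, by simp; omega⟩
  have liftA : ∀ t ∈ A, ∃ k : Fin n, t = k.val + 1 := by
    intro t ht
    rw [hA, Finset.mem_filter, Finset.mem_Icc] at ht
    exact lift1 t ht.1.1 ht.1.2
  have liftB : ∀ t ∈ B, ∃ k : Fin n, t = k.val + 1 := by
    intro t ht
    rw [hB, Finset.mem_filter, Finset.mem_Icc] at ht
    exact lift1 t ht.1.1 ht.1.2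
  have hσ : ∀ k l : Fin n, v ((w0 n)⁻¹ l) = k → (w0 n * v⁻¹) k = l := by
    rintro k l rfl
    simp
  obtain ⟨h1, h2, h3, h4, h5, h6, h7, -, -, -⟩ := H
  refine ⟨w0 n * v⁻¹, ?_, ?_, ?_, ?_, ?_, by simp⟩
  · intro t ht1 ht2 ht
    obtain ⟨k, rfl⟩ := lift1 t ht1 ht2
    rw [app_succ, hσ k k]
    have hk : ¬ (Af k ∨ Bf k) := by
      rw [hcov, Fin.le_def, Fin.le_def]
      omega
    exact h7 k (fun h => hk (Or.inl (h1 k h))) (fun h => hk (Or.inr (h2 k h)))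
  · intro t ht t' ht' htt' hs
    obtain ⟨k, rfl⟩ := liftA t ht
    obtain ⟨l, rfl⟩ := liftA t' ht'
    rw [mA] at ht ht'
    rw [app_succ, hσ k l]
    have hk := (hcov k).1 (Or.inl (h1 k ht))
    have hkl : k < l := by rw [Fin.lt_def]; omega
    obtain ⟨q1, q2, q3⟩ := h5 l (Or.inl ⟨ht', (hk.1.trans_lt hkl).ne'⟩)
    have q4 := hs _ ((mA _).2 q1)
    have q5 := q3 k ht hkl
    rw [Fin.lt_def] at q2
    rw [Fin.le_def] at q5
    apply Fin.ext
    omega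
  · intro t ht hs
    obtain ⟨k, rfl⟩ := liftA t ht
    rw [mA] at ht
    rw [app_succ, hσ k (u R), hc']
    have hk := (hcov k).1 (Or.inl (h1 k ht))
    have hne : k ≠ u R := by
      rintro rfl
      exact hd _ (h1 _ ht) (h2 _ h4)
    obtain ⟨q1, q2, q3⟩ := h5 (u R) (Or.inr rfl)
    have q4 := hs _ ((mA _).2 q1)
    have q5 := q3 k ht (lt_of_le_of_ne hk.2 hne)
    rw [Fin.le_def] at q5
    apply Fin.ext
    omega
  · intro t ht t' ht' htt' hs
    obtain ⟨k, rfl⟩ := liftB t ht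
    obtain ⟨l, rfl⟩ := liftB t' ht'
    rw [mB] at ht ht'
    rw [app_succ, hσ k l]
    have hk := (hcov k).1 (Or.inr (h2 k ht))
    have hkl : l < k := by rw [Fin.lt_def]; omega
    obtain ⟨q1, q2, q3⟩ := h6 l (Or.inl ⟨ht', (hkl.trans_le hk.2).ne⟩)
    have q4 := hs _ ((mB _).2 q1)
    have q5 := q3 k ht hkl
    rw [Fin.lt_def] at q2
    rw [Fin.le_def] at q5
    apply Fin.ext
    omega
  · intro t ht hs
    obtain ⟨k, rfl⟩ := liftB t ht
    rw [mB] at ht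
    rw [app_succ, hσ k (u P), ha']
    have hk := (hcov k).1 (Or.inr (h2 k ht))
    have hne : u P ≠ k := by
      rintro rfl
      exact hd _ (h1 _ h3) (h2 _ ht)
    obtain ⟨q1, q2, q3⟩ := h6 (u P) (Or.inr rfl)
    have q4 := hs _ ((mB _).2 q1)
    have q5 := q3 k ht (lt_of_le_of_ne hk.1 hne)
    rw [Fin.le_def] at q5
    apply Fin.ext
    omega

end BSDist
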